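/- arXiv:2004.11552 — 2 statements merged into one kernel-verified Lean document; each statement's English description precedes it below -/
import Mathlib

section
/- For every n ≥ 2, the minimal number of padlocks for a 2-out-of-n threshold padlock system is exactly ℓ(2, n) = min { t : ℕ | Nat.choose t (t / 2) ≥ n }, i.e. the least t whose central binomial coefficient C(t, ⌊t/2⌋) is at least n. -/
/-- A `k`-out-of-`n` threshold padlock system with `t` padlocks. -/
def IsThresholdSystem (k n t : ℕ) (F : Finset (Fin t) → Prop)
    (S : Fin n → Finset (Fin t)) : Prop :=
  (∀ A B : Finset (Fin t), A ⊆ B → F A → F B) ∧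
  ∀ G : Finset (Fin n), F (G.biUnion S) ↔ k ≤ G.card

/-- `ℓ(k, n)`: the minimal number of padlocks in any `k`-out-of-`n`
threshold padlock system. -/
noncomputable def padlockNumber (k n : ℕ) : ℕ :=
  sInf {t | ∃ (F : Finset (Fin t) → Prop) (S : Fin n → Finset (Fin t)),
    IsThresholdSystem k n t F S}

theorem IsThresholdSystem.le_centralChoose {n t : ℕ} {F : Finset (Fin t) → Prop}
    {S : Fin n → Finset (Fin t)} (h : IsThresholdSystem 2 n t F S) :
    n ≤ t.choose (t / 2) := by
  have key : ∀ i j, S i ⊆ S j → i = j := by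
    intro i j hij
    by_contra hne
    have h2 := (h.2 {i, j}).2 (Finset.card_pair hne).ge
    have h1 := h.2 {j}
    rw [Finset.biUnion_insert, Finset.singleton_biUnion, Finset.union_eq_right.2 hij] at h2
    rw [Finset.singleton_biUnion, Finset.card_singleton] at h1
    exact absurd (h1.1 h2) (by norm_num)
  have hinj : Function.Injective S := fun i j hij => key i j hij.subset
  have hanti : IsAntichain (· ⊆ ·)
      (SetLike.coe (Finset.univ.image S) : Set (Finset (Fin t))) := by
    intro A hA B hB hne hsub
    obtain ⟨i, -, rfl⟩ := Finset.mem_image.1 hA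
    obtain ⟨j, -, rfl⟩ := Finset.mem_image.1 hB
    exact hne (congrArg S (key i j hsub))
  simpa [Finset.card_image_of_injective _ hinj] using hanti.sperner

theorem exists_isThresholdSystem_two {n t : ℕ} (h : n ≤ t.choose (t / 2)) :
    ∃ (F : Finset (Fin t) → Prop) (S : Fin n → Finset (Fin t)),
      IsThresholdSystem 2 n t F S := by
  have hcard : Fintype.card (Fin n) ≤
      Fintype.card (Finset.powersetCard (t / 2) (Finset.univ : Finset (Fin t))) := by
    simpa using h
  obtain ⟨f⟩ := Function.Embedding.nonempty_of_card_le hcard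
  have hS : ∀ i, (f i : Finset (Fin t)).card = t / 2 := fun i =>
    (Finset.mem_powersetCard.1 (f i).2).2
  refine ⟨fun A => t / 2 < A.card, fun i => f i,
    fun A B hAB hA => hA.trans_le (Finset.card_le_card hAB), fun G => ⟨fun hG => ?_, fun hG => ?_⟩⟩
  · by_contra! hlt
    have hle := Finset.card_biUnion_le_card_mul G (fun i => (f i : Finset (Fin t))) (t / 2)
      fun i _ => (hS i).le
    have hmul := Nat.mul_le_mul_right (t / 2) (Nat.le_of_lt_succ hlt)
    omega
  · obtain ⟨a, ha, b, hb, hab⟩ := Finset.one_lt_card.1 hG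
    have hsub : ∀ i ∈ G, (f i : Finset (Fin t)) ⊆ G.biUnion fun i => (f i : Finset (Fin t)) :=
      fun i hi => Finset.subset_biUnion_of_mem (fun i => (f i : Finset (Fin t))) hi
    by_contra! hle
    have heq : ∀ i ∈ G, (f i : Finset (Fin t)) = G.biUnion fun i => (f i : Finset (Fin t)) :=
      fun i hi => Finset.eq_of_subset_of_card_le (hsub i hi) (hle.trans (hS i).ge)
    exact hab (f.injective (Subtype.ext ((heq a ha).trans (heq b hb).symm)))

/-- Optimal `2`-out-of-`n` systems: `ℓ(2, n)` is exactly the least `t`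
with central binomial coefficient `C(t, ⌊t/2⌋) ≥ n`. -/
theorem two_threshold_optimal (n : ℕ) (hn : 2 ≤ n) :
    padlockNumber 2 n = sInf {t : ℕ | n ≤ Nat.choose t (t / 2)} := by
  unfold padlockNumber
  congr 1
  ext t
  exact ⟨fun ⟨_, _, h⟩ => h.le_centralChoose, exists_isThresholdSystem_two⟩
end

section
/- Let k ≥ 3, n ≥ k, and let (F, S) be a k-out-of-n threshold padlock system with t padlocks where t < n. Call a participant i 'shared-only' if every key of i is also owned by some other participant, i.e. for every p ∈ S i there exists j ≠ i with p ∈ S j. Then: (1) for any two distinct shared-only participants i and j, the set difference satisfies (S i \ S j).card ≥ k − 1; and (2) every shared-only participant i owns at least k keys, i.e. (S i).card ≥ k. -/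
/-- Participant `i` is shared-only if each of their keys is also owned by
some other participant. -/
def SharedOnly {n t : ℕ} (S : Fin n → Finset (Fin t)) (i : Fin n) : Prop :=
  ∀ p ∈ S i, ∃ j : Fin n, j ≠ i ∧ p ∈ S j

/-- In a threshold system, fewer than `k` participants never own all the keys of another one. -/
theorem IsThresholdSystem.not_subset_biUnion {k n t : ℕ} {F : Finset (Fin t) → Prop}
    {S : Fin n → Finset (Fin t)} (h : IsThresholdSystem k n t F S) (hn : k ≤ n) {i : Fin n}
    {B : Finset (Fin n)} (hi : i ∉ B) (hB : B.card < k) : ¬ S i ⊆ B.biUnion S := by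
  intro hcover
  have hBi : B ⊆ Finset.univ.erase i := fun x hx =>
    Finset.mem_erase.2 ⟨fun hxi => hi (hxi ▸ hx), Finset.mem_univ x⟩
  obtain ⟨C, hBC, hCi, hC⟩ := Finset.exists_subsuperset_card_eq (n := k - 1) hBi
    (by omega) (by simp; omega)
  have hiC : i ∉ C := fun hmem => (Finset.mem_erase.1 (hCi hmem)).1 rfl
  have hunion : (insert i C).biUnion S = C.biUnion S := by
    rw [Finset.biUnion_insert, Finset.union_eq_right]
    exact hcover.trans (Finset.biUnion_subset_biUnion_of_subset_left S hBC)
  have hF : F ((insert i C).biUnion S) :=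
    (h.2 _).2 (by rw [Finset.card_insert_of_notMem hiC]; omega)
  rw [hunion, h.2] at hF
  omega

/-- The keys of a shared-only participant lying in `T` are jointly owned by at most `T.card`
other participants. -/
theorem SharedOnly.exists_cover {n t : ℕ} {S : Fin n → Finset (Fin t)} {i : Fin n}
    (hi : SharedOnly S i) {T : Finset (Fin t)} (hT : T ⊆ S i) :
    ∃ B : Finset (Fin n), i ∉ B ∧ B.card ≤ T.card ∧ T ⊆ B.biUnion S := by
  have : Nonempty (Fin n) := ⟨i⟩
  choose! f hne hmem using hi
  refine ⟨T.image f, ?_, Finset.card_image_le, fun p hp => ?_⟩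
  · rw [Finset.mem_image]
    rintro ⟨p, hp, hpi⟩
    exact hne p (hT hp) hpi
  · exact Finset.mem_biUnion.2 ⟨f p, Finset.mem_image_of_mem f hp, hmem p (hT hp)⟩

/-- Necessary condition for systems with fewer than `n` padlocks (`k ≥ 3`):
shared-only participants have pairwise set differences of at least `k - 1`
keys, and each of them owns at least `k` keys. -/
theorem sharedOnly_necessary_condition (k n t : ℕ) (hk : 3 ≤ k) (hn : k ≤ n)
    (ht : t < n) (F : Finset (Fin t) → Prop) (S : Fin n → Finset (Fin t))
    (h : IsThresholdSystem k n t F S) :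
    (∀ i j : Fin n, SharedOnly S i → SharedOnly S j → i ≠ j →
      k - 1 ≤ (S i \ S j).card) ∧
    (∀ i : Fin n, SharedOnly S i → k ≤ (S i).card) := by
  constructor
  · intro i j hi _ hij
    obtain ⟨B, hiB, hB, hcover⟩ := hi.exists_cover (T := S i \ S j) Finset.sdiff_subset
    by_contra hlt
    have hcard := Finset.card_insert_le j B
    refine h.not_subset_biUnion hn (i := i) (B := insert j B) (by simp [hij, hiB]) (by omega) ?_
    rw [Finset.biUnion_insert]
    exact sdiff_le_iff.1 hcover
  · intro i hi
    obtain ⟨B, hiB, hB, hcover⟩ := hi.exists_cover subset_rfl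
    by_contra hlt
    exact h.not_subset_biUnion hn hiB (by omega) hcover
end
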